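/- arXiv:2407.07887 — 5 statements merged into one kernel-verified Lean document; each statement's English description precedes it below -/
import Mathlib

section
/- Fix ε > 0 and v > 0. Let d ≥ 1, let e be a unit vector in Euclidean space ℝ^d, let z ∈ ℝ^d, and let ℓ = {z + u·e : u ∈ ℝ} be the line through z with direction e. Let x ∈ ℝ^d with x ∉ ℓ. Define φ(u) = ‖(z + u·e) − x‖/ε + |u|/v for u ∈ ℝ. If u* ≠ 0 is such that φ(u*) ≤ φ(u) for all u ≠ 0, then |⟪(z + u*·e − x)/‖z + u*·e − x‖, e⟫| = ε/v. -/
open scoped RealInnerProductSpace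

/-- The norm of a differentiable curve is differentiable wherever the curve does not vanish. -/
theorem HasDerivAt.norm_of_ne_zero {E : Type*} [NormedAddCommGroup E] [InnerProductSpace ℝ E]
    {f : ℝ → E} {f' : E} {t : ℝ} (hf : HasDerivAt f f' t) (h0 : f t ≠ 0) :
    HasDerivAt (fun s => ‖f s‖) (‖f t‖⁻¹ * ⟪f t, f'⟫) t := by
  have hn : ‖f t‖ ≠ 0 := norm_ne_zero_iff.mpr h0
  have h := hf.norm_sq.sqrt (pow_ne_zero 2 hn)
  simp only [Real.sqrt_sq (norm_nonneg _)] at h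
  convert h using 1
  field_simp

/-- First-order condition for leaving a road: if driving straight at speed `ε` from `x` to a
point `z + u*·e` of the line `ℓ` through `z` with unit direction `e`, and then along `ℓ` at
speed `v` to `z`, minimizes the total driving time among all `u ≠ 0`, then the direction of
the straight segment makes an angle with `ℓ` whose cosine has absolute value `ε/v`. -/
theorem offroad_first_order_condition
    (ε v : ℝ) (hε : 0 < ε) (hv : 0 < v)
    (d : ℕ) (hd : 1 ≤ d)
    (e z x : EuclideanSpace ℝ (Fin d)) (he : ‖e‖ = 1)
    (hx : x ∉ {p : EuclideanSpace ℝ (Fin d) | ∃ u : ℝ, p = z + u • e})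
    (φ : ℝ → ℝ) (hφ : ∀ u : ℝ, φ u = ‖(z + u • e) - x‖ / ε + |u| / v)
    (u₀ : ℝ) (hu₀ : u₀ ≠ 0) (hmin : ∀ u : ℝ, u ≠ 0 → φ u₀ ≤ φ u) :
    |⟪(‖z + u₀ • e - x‖)⁻¹ • (z + u₀ • e - x), e⟫| = ε / v := by
  have hw : z + u₀ • e - x ≠ 0 := fun h => hx ⟨u₀, (sub_eq_zero.mp h).symm⟩
  have hline : HasDerivAt (fun u : ℝ => z + u • e - x) e u₀ := by
    simpa using (((hasDerivAt_id u₀).smul_const e).const_add z).sub_const x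
  have hderiv := ((hline.norm_of_ne_zero hw).div_const ε).add ((hasDerivAt_abs hu₀).div_const v)
  have hlocal : IsLocalMin φ u₀ := (isOpen_ne.eventually_mem hu₀).mono hmin
  rw [funext hφ] at hlocal
  have hzero := hlocal.hasDerivAt_eq_zero hderiv
  rw [real_inner_smul_left]
  set c := ‖z + u₀ • e - x‖⁻¹ * ⟪z + u₀ • e - x, e⟫
  have hc : c = -((SignType.sign u₀ : ℝ) * (ε / v)) := by
    field_simp at hzero ⊢
    linarith
  have hpos : 0 < ε / v := div_pos hε hv
  rw [hc, abs_neg, abs_mul, abs_of_pos hpos]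
  rcases hu₀.lt_or_gt with h | h <;> simp [h]
end

section
/- Let d ≥ 2 and ρ ∈ (0,1). There exist K ∈ ℕ and a constant C > 0 such that for every pair of points x, y on the unit sphere {p ∈ ℝ^d : ‖p‖ = 1}, there exist k ≤ K and points z_0, z_1, …, z_k on the unit sphere with z_0 = x, z_k = y, z_{i−1} ≠ z_i for every i ∈ {1,…,k}, the Euclidean distance from the origin to the closed segment [z_{i−1}, z_i] strictly greater than ρ for every i ∈ {1,…,k}, and ‖z_0 − z_1‖ + ⋯ + ‖z_{k−1} − z_k‖ ≤ C. -/
section UnitVectors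

variable {E : Type*} [NormedAddCommGroup E] [InnerProductSpace ℝ E]

/-- The point at angle `t` on the great circle through the orthonormal vectors `x`, `u`. -/
noncomputable def greatCircle (x u : E) (t : ℝ) : E := Real.cos t • x + Real.sin t • u

lemma inner_greatCircle {x u : E} (hx : ‖x‖ = 1) (hu : ‖u‖ = 1) (hxu : inner ℝ x u = 0)
    (s t : ℝ) : inner ℝ (greatCircle x u s) (greatCircle x u t) = Real.cos (s - t) := by
  have hux : inner ℝ u x = 0 := by rw [real_inner_comm, hxu]
  simp only [greatCircle, inner_add_left, inner_add_right, real_inner_smul_left,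
    real_inner_smul_right, hxu, hux, real_inner_self_eq_norm_sq, hx, hu, Real.cos_sub]
  ring

lemma norm_greatCircle {x u : E} (hx : ‖x‖ = 1) (hu : ‖u‖ = 1) (hxu : inner ℝ x u = 0)
    (t : ℝ) : ‖greatCircle x u t‖ = 1 := by
  have h := inner_greatCircle hx hu hxu t t
  rw [real_inner_self_eq_norm_sq, sub_self, Real.cos_zero] at h
  exact (pow_eq_one_iff_of_nonneg (norm_nonneg _) two_ne_zero).mp h

lemma norm_greatCircle_sub_le {x u : E} (hx : ‖x‖ = 1) (hu : ‖u‖ = 1) (hxu : inner ℝ x u = 0)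
    (s t : ℝ) : ‖greatCircle x u s - greatCircle x u t‖ ≤ |s - t| := by
  have h := norm_sub_sq_real (greatCircle x u s) (greatCircle x u t)
  rw [inner_greatCircle hx hu hxu, norm_greatCircle hx hu hxu, norm_greatCircle hx hu hxu] at h
  refine abs_le_of_sq_le_sq' ?_ (abs_nonneg _) |>.2
  rw [h, sq_abs]
  linarith [Real.one_sub_sq_div_two_le_cos (x := s - t)]

lemma greatCircle_ne {x u : E} (hx : ‖x‖ = 1) (hu : ‖u‖ = 1) (hxu : inner ℝ x u = 0)
    {s t : ℝ} (hne : s ≠ t) (hlt : |s - t| < 2 * Real.pi) :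
    greatCircle x u s ≠ greatCircle x u t := by
  intro h
  have h' := inner_greatCircle hx hu hxu s t
  rw [h, inner_greatCircle hx hu hxu, sub_self, Real.cos_zero] at h'
  have := (Real.cos_eq_one_iff_of_lt_of_lt (abs_lt.mp hlt).1 (abs_lt.mp hlt).2).mp h'.symm
  exact hne (sub_eq_zero.mp this)

lemma norm_sub_norm_sub_le_infDist_segment (p q : E) :
    ‖p‖ - ‖p - q‖ ≤ Metric.infDist (0 : E) (segment ℝ p q) := by
  refine (Metric.le_infDist ⟨p, left_mem_segment ℝ p q⟩).mpr fun w hw => ?_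
  have h : ‖w - p‖ ≤ ‖q - p‖ := norm_sub_le_of_mem_segment hw
  rw [dist_zero_left, norm_sub_rev p q]
  linarith [norm_sub_norm_le p w, norm_sub_rev p w]

lemma exists_unit_orthogonal [FiniteDimensional ℝ E] (hd : 2 ≤ Module.finrank ℝ E) (x : E) :
    ∃ u : E, ‖u‖ = 1 ∧ inner ℝ x u = 0 := by
  have hsum := Submodule.finrank_add_finrank_orthogonal (ℝ ∙ x)
  have hle : Module.finrank ℝ (ℝ ∙ x) ≤ 1 := by
    simpa using finrank_span_le_card (R := ℝ) ({x} : Set E)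
  have hne : (ℝ ∙ x)ᗮ ≠ ⊥ := by
    intro h
    rw [h, finrank_bot] at hsum
    omega
  obtain ⟨v, hv, hv0⟩ := Submodule.exists_mem_ne_zero_of_ne_bot hne
  refine ⟨‖v‖⁻¹ • v, norm_smul_inv_norm hv0, ?_⟩
  rw [real_inner_smul_right, Submodule.mem_orthogonal_singleton_iff_inner_right.mp hv, mul_zero]

lemma exists_greatCircle_eq [FiniteDimensional ℝ E] (hd : 2 ≤ Module.finrank ℝ E) {x y : E}
    (hx : ‖x‖ = 1) (hy : ‖y‖ = 1) :
    ∃ (u : E) (θ : ℝ), ‖u‖ = 1 ∧ inner ℝ x u = 0 ∧ |θ| ≤ Real.pi ∧ greatCircle x u θ = y := by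
  obtain ⟨u, s, hu, hxu, hs⟩ : ∃ (u : E) (s : ℝ), ‖u‖ = 1 ∧ inner ℝ x u = 0 ∧
      y = (inner ℝ x y : ℝ) • x + s • u := by
    by_cases hw : y - (inner ℝ x y : ℝ) • x = 0
    · obtain ⟨u, hu, hxu⟩ := exists_unit_orthogonal hd x
      exact ⟨u, 0, hu, hxu, by rw [zero_smul, add_zero]; exact sub_eq_zero.mp hw⟩
    · refine ⟨‖y - (inner ℝ x y : ℝ) • x‖⁻¹ • (y - (inner ℝ x y : ℝ) • x),
        ‖y - (inner ℝ x y : ℝ) • x‖, norm_smul_inv_norm hw, ?_, ?_⟩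
      · simp [real_inner_smul_right, inner_sub_right, hx]
      · rw [smul_inv_smul₀ (norm_ne_zero_iff.mpr hw), add_sub_cancel]
  generalize (inner ℝ x y : ℝ) = c at hs
  have hcs : c ^ 2 + s ^ 2 = 1 := by
    have h := norm_add_sq_real (c • x) (s • u)
    rw [← hs, real_inner_smul_left, real_inner_smul_right, hxu, norm_smul, norm_smul, hx, hu, hy]
      at h
    simp only [Real.norm_eq_abs, mul_one, sq_abs] at h
    linarith
  have hnorm : ‖(⟨c, s⟩ : ℂ)‖ = 1 := by
    rw [Complex.norm_def, Complex.normSq_mk, ← sq, ← sq, hcs, Real.sqrt_one]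
  have hne : (⟨c, s⟩ : ℂ) ≠ 0 := norm_ne_zero_iff.mp (by rw [hnorm]; exact one_ne_zero)
  refine ⟨u, Complex.arg ⟨c, s⟩, hu, hxu, Complex.abs_arg_le_pi _, ?_⟩
  rw [greatCircle, Complex.cos_arg hne, Complex.sin_arg, hnorm, div_one, div_one, hs]

end UnitVectors


/-- A circular arc on the unit sphere can be approximated by a bounded number of chords,
each staying at distance greater than `ρ` from the origin, with total length bounded by a
constant. -/
theorem chords_avoiding_ball
    (d : ℕ) (hd : 2 ≤ d) (ρ : ℝ) (hρ : ρ ∈ Set.Ioo (0 : ℝ) 1) :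
    ∃ (K : ℕ) (C : ℝ), 0 < C ∧
      ∀ x y : EuclideanSpace ℝ (Fin d), ‖x‖ = 1 → ‖y‖ = 1 →
        ∃ (k : ℕ) (z : ℕ → EuclideanSpace ℝ (Fin d)),
          k ≤ K ∧ z 0 = x ∧ z k = y ∧
          (∀ i ≤ k, ‖z i‖ = 1) ∧
          (∀ i < k, z i ≠ z (i + 1)) ∧
          (∀ i < k, ρ < Metric.infDist (0 : EuclideanSpace ℝ (Fin d))
            (segment ℝ (z i) (z (i + 1)))) ∧
          ∑ i ∈ Finset.range k, ‖z i - z (i + 1)‖ ≤ C := by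
  obtain ⟨n, hn⟩ := exists_nat_gt (Real.pi / (1 - ρ))
  have hρ1 : 0 < 1 - ρ := sub_pos.mpr hρ.2
  have hn0 : (0 : ℝ) < n := (div_pos Real.pi_pos hρ1).trans hn
  have hstep : Real.pi / n < 1 - ρ := (div_lt_comm₀ hρ1 hn0).mp hn
  refine ⟨n, Real.pi, Real.pi_pos, fun x y hx hy => ?_⟩
  by_cases hxy : x = y
  · exact ⟨0, fun _ => x, by simp [← hxy, hx, Real.pi_pos.le]⟩
  obtain ⟨u, θ, hu, hxu, hθ, rfl⟩ := exists_greatCircle_eq (by simpa using hd) hx hy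
  have hθ0 : θ ≠ 0 := by
    rintro rfl
    simp [greatCircle] at hxy
  have hdiff (i : ℕ) : (i * (θ / n) - (i + 1 : ℕ) * (θ / n) : ℝ) = -(θ / n) := by
    push_cast
    ring
  have habs (i : ℕ) : |(i * (θ / n) - (i + 1 : ℕ) * (θ / n) : ℝ)| ≤ Real.pi / n := by
    rw [hdiff, abs_neg, abs_div, Nat.abs_cast]
    gcongr
  have hlen (i : ℕ) := (norm_greatCircle_sub_le hx hu hxu (i * (θ / n))
    ((i + 1 : ℕ) * (θ / n))).trans (habs i)
  refine ⟨n, fun i => greatCircle x u (i * (θ / n)), le_rfl, by simp [greatCircle],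
    by simp only [mul_div_cancel₀ θ hn0.ne'], fun i _ => norm_greatCircle hx hu hxu _,
    fun i _ => ?_, fun i _ => ?_, ?_⟩
  · refine greatCircle_ne hx hu hxu ?_ ((habs i).trans_lt ?_)
    · rw [← sub_ne_zero, hdiff]
      exact neg_ne_zero.mpr (div_ne_zero hθ0 hn0.ne')
    · linarith [hρ.1, Real.pi_gt_three]
  · refine lt_of_lt_of_le ?_ (norm_sub_norm_sub_le_infDist_segment _ _)
    rw [norm_greatCircle hx hu hxu]
    linarith [hlen i]
  · refine (Finset.sum_le_card_nsmul _ _ _ fun i _ => hlen i).trans_eq ?_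
    rw [Finset.card_range, nsmul_eq_mul, mul_div_cancel₀ _ hn0.ne']
end

section
/- Let d ≥ 2 be an integer, β > d, and α ∈ (0,1) with 2·α^{(β−d)/(β−1)} < 1. Then there exists a constant C > 0 such that for every s ∈ (0, 2], Σ_{n=0}^∞ 2^n·(α^n·s)^{(β−d)/(β−1)}·(ln(4/(α^{n+1}·s)))^{1/(β−1)} ≤ C·s^{(β−d)/(β−1)}·(ln(4/s))^{1/(β−1)}. -/
theorem log_scale_nonneg {α s : ℝ} (hα : α ∈ Set.Ioo (0 : ℝ) 1) (hs : s ∈ Set.Ioc (0 : ℝ) 2)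
    (n : ℕ) : 0 ≤ Real.log (4 / (α ^ (n + 1) * s)) := by
  have hα0 := hα.1
  have hs0 := hs.1
  refine Real.log_nonneg ?_
  rw [le_div_iff₀ (by positivity)]
  nlinarith [pow_le_one₀ (n := n + 1) hα0.le hα.2.le, hs.2]

/-- Enlarging the logarithm by `n + 1` steps of the scale `α` costs at most a linear factor. -/
theorem log_scale_le {α s : ℝ} (hα : α ∈ Set.Ioo (0 : ℝ) 1) (hs : s ∈ Set.Ioc (0 : ℝ) 2)
    (n : ℕ) :
    Real.log (4 / (α ^ (n + 1) * s)) ≤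
      (1 - Real.log α / Real.log 2) * (n + 1) * Real.log (4 / s) := by
  obtain ⟨hα0, hα1⟩ := hα
  obtain ⟨hs0, hs2⟩ := hs
  have hlog2 : 0 < Real.log 2 := Real.log_pos one_lt_two
  have hM : Real.log 2 ≤ Real.log (4 / s) :=
    Real.log_le_log two_pos (by rw [le_div_iff₀ hs0]; linarith)
  have hL : 0 ≤ -Real.log α / Real.log 2 :=
    div_nonneg (by linarith [Real.log_neg hα0 hα1]) hlog2.le
  have hsplit : Real.log (4 / (α ^ (n + 1) * s)) =
      Real.log (4 / s) + (n + 1) * (-Real.log α / Real.log 2) * Real.log 2 := by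
    rw [mul_comm (α ^ (n + 1)), ← div_div, Real.log_div (by positivity) (by positivity),
      Real.log_pow]
    push_cast
    field_simp
    ring
  have hstep : (n + 1) * (-Real.log α / Real.log 2) * Real.log 2 ≤
      (n + 1) * (-Real.log α / Real.log 2) * Real.log (4 / s) := by gcongr
  have hn : 0 ≤ (n : ℝ) * Real.log (4 / s) := by have := hlog2.trans_le hM; positivity
  rw [hsplit]
  calc _ ≤ _ := add_le_add_right hstep _
    _ ≤ _ := by rw [neg_div]; linarith

/-- Each term of the series is dominated by an arithmetico-geometric term. -/
theorem scale_term_le {α s p q : ℝ} (hα : α ∈ Set.Ioo (0 : ℝ) 1) (hs : s ∈ Set.Ioc (0 : ℝ) 2)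
    (hq0 : 0 ≤ q) (hq1 : q ≤ 1) (n : ℕ) :
    (2 : ℝ) ^ n * (α ^ n * s) ^ p * Real.log (4 / (α ^ (n + 1) * s)) ^ q ≤
      (1 - Real.log α / Real.log 2) * ((n + 1) * (2 * α ^ p) ^ n) *
        (s ^ p * Real.log (4 / s) ^ q) := by
  have hα0 := hα.1
  have hs0 := hs.1
  have hM : 0 ≤ Real.log (4 / s) :=
    Real.log_nonneg (by rw [le_div_iff₀ hs0]; linarith [hs.2])
  have hlog := log_scale_nonneg hα hs n
  have hK : 1 ≤ 1 - Real.log α / Real.log 2 := by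
    linarith [div_nonpos_of_nonpos_of_nonneg (Real.log_neg hα0 hα.2).le
      (Real.log_pos one_lt_two).le]
  have hKn : 1 ≤ (1 - Real.log α / Real.log 2) * ((n : ℝ) + 1) :=
    one_le_mul_of_one_le_of_one_le hK (by linarith [n.cast_nonneg (α := ℝ)])
  have hpow : Real.log (4 / (α ^ (n + 1) * s)) ^ q ≤
      (1 - Real.log α / Real.log 2) * (n + 1) * Real.log (4 / s) ^ q := by
    calc _ ≤ ((1 - Real.log α / Real.log 2) * (n + 1) * Real.log (4 / s)) ^ q :=
          Real.rpow_le_rpow hlog (log_scale_le hα hs n) hq0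
      _ = ((1 - Real.log α / Real.log 2) * (n + 1)) ^ q * Real.log (4 / s) ^ q :=
          Real.mul_rpow (by linarith) hM
      _ ≤ _ := by
          gcongr
          exact Real.rpow_le_self_of_one_le hKn hq1
  have hscale : (α ^ n * s) ^ p = (α ^ p) ^ n * s ^ p := by
    rw [Real.mul_rpow (by positivity) hs0.le, ← Real.rpow_natCast, ← Real.rpow_natCast,
      ← Real.rpow_mul hα0.le, ← Real.rpow_mul hα0.le, mul_comm p]
  rw [hscale]
  calc _ ≤ _ := mul_le_mul_of_nonneg_left hpow (by positivity)
    _ = _ := by rw [mul_pow]; ring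

/-- Summing the driving-time contributions over the binary tree of scales in Kendall's
recursive construction of V-paths: if `2·α^{(β−d)/(β−1)} < 1` then the geometric-type series
is summable and bounded by `C·s^{(β−d)/(β−1)}·(ln(4/s))^{1/(β−1)}`, uniformly in
`s ∈ (0, 2]`. -/
theorem scales_series_bound
    (d : ℕ) (hd : 2 ≤ d) (β : ℝ) (hβ : (d : ℝ) < β)
    (α : ℝ) (hα : α ∈ Set.Ioo (0 : ℝ) 1)
    (h2α : 2 * α ^ ((β - d) / (β - 1)) < 1) :
    ∃ C > (0 : ℝ), ∀ s ∈ Set.Ioc (0 : ℝ) 2,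
      Summable (fun n : ℕ => (2 : ℝ) ^ n * (α ^ n * s) ^ ((β - d) / (β - 1)) *
        (Real.log (4 / (α ^ (n + 1) * s))) ^ (1 / (β - 1))) ∧
      ∑' n : ℕ, (2 : ℝ) ^ n * (α ^ n * s) ^ ((β - d) / (β - 1)) *
          (Real.log (4 / (α ^ (n + 1) * s))) ^ (1 / (β - 1))
        ≤ C * s ^ ((β - d) / (β - 1)) * (Real.log (4 / s)) ^ (1 / (β - 1)) := by
  obtain ⟨hα0, hα1⟩ := hα
  have hβ2 : 2 < β := lt_of_le_of_lt (by exact_mod_cast hd) hβ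
  set p := (β - d) / (β - 1)
  have hq0 : 0 ≤ 1 / (β - 1) := one_div_nonneg.2 (by linarith)
  have hq1 : 1 / (β - 1) ≤ 1 := by rw [div_le_one (by linarith)]; linarith
  set q := 1 / (β - 1)
  set K := 1 - Real.log α / Real.log 2
  have hK : 0 < K := by
    linarith [div_neg_of_neg_of_pos (Real.log_neg hα0 hα1) (Real.log_pos one_lt_two)]
  have hr0 : 0 < 2 * α ^ p := by positivity
  have hnorm : ‖2 * α ^ p‖ < 1 := by rwa [Real.norm_of_nonneg hr0.le]
  have hsum : Summable fun n : ℕ => K * (((n : ℝ) + 1) * (2 * α ^ p) ^ n) := by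
    refine Summable.mul_left K ?_
    simpa [add_mul] using (summable_pow_mul_geometric_of_norm_lt_one 1 hnorm).add
      (summable_geometric_of_norm_lt_one hnorm)
  refine ⟨∑' n : ℕ, K * (((n : ℝ) + 1) * (2 * α ^ p) ^ n),
    hsum.tsum_pos (fun n => by positivity) 0 (by simpa using hK), fun s hs => ?_⟩
  have hterm := scale_term_le (p := p) ⟨hα0, hα1⟩ hs hq0 hq1
  have hdom := hsum.mul_right (s ^ p * Real.log (4 / s) ^ q)
  have hsummable := Summable.of_nonneg_of_le (fun n => ?_) hterm hdom
  · refine ⟨hsummable, ?_⟩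
    rw [mul_assoc, ← tsum_mul_right]
    exact hsummable.tsum_le_tsum hterm hdom
  · have hs0 := hs.1
    have hlog := log_scale_nonneg ⟨hα0, hα1⟩ hs n
    positivity
end

section
/- Let ε > 0, v1 > 0, let σ1, σ2 ∈ {−1, 1}, and let f1 and u be linearly independent vectors in the Euclidean plane ℝ². Then the set { v2 ∈ ℝ : v2 > 0 and there exists e ∈ ℝ² with ‖e‖ = 1, ⟪e, f1⟫ = σ1·ε/v1 and ⟪e, u⟫ = σ2·ε/v2 } has at most two elements. -/
open scoped RealInnerProductSpace

/-- Given linearly independent `f1, u` in the plane, speeds `v2` for which some unit vector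
`e` satisfies `⟪e, f1⟫ = σ1·ε/v1` and `⟪e, u⟫ = σ2·ε/v2` are at most two in number. -/
theorem at_most_two_speeds
    (ε v1 : ℝ) (hε : 0 < ε) (hv1 : 0 < v1)
    (σ1 σ2 : ℝ) (hσ1 : σ1 = 1 ∨ σ1 = -1) (hσ2 : σ2 = 1 ∨ σ2 = -1)
    (f1 u : EuclideanSpace ℝ (Fin 2)) (hli : LinearIndependent ℝ ![f1, u]) :
    ∃ a b : ℝ,
      {v2 : ℝ | 0 < v2 ∧ ∃ e : EuclideanSpace ℝ (Fin 2),
          ‖e‖ = 1 ∧ ⟪e, f1⟫ = σ1 * ε / v1 ∧ ⟪e, u⟫ = σ2 * ε / v2} ⊆ {a, b} := by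
  have hf : f1 ≠ 0 := hli.ne_zero 0
  have hN : 0 < f1 0 ^ 2 + f1 1 ^ 2 := by
    simpa [EuclideanSpace.norm_sq_eq, Fin.sum_univ_two] using pow_pos (norm_pos_iff.mpr hf) 2
  have hσ : σ2 ≠ 0 := by rcases hσ2 with rfl | rfl <;> norm_num
  set c := σ1 * ε / v1
  set N := f1 0 ^ 2 + f1 1 ^ 2 with hNdef
  set d := √(N - c ^ 2)
  -- the value of `v2` when `e` has component `w` along `f1` rotated by a right angle
  let g : ℝ → ℝ := fun w =>
    σ2 * ε * N / (c * (f1 0 * u 0 + f1 1 * u 1) + w * (f1 0 * u 1 - f1 1 * u 0))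
  refine ⟨g d, g (-d), ?_⟩
  rintro v ⟨hv, e, he, h1, h2⟩
  have he2 : e 0 ^ 2 + e 1 ^ 2 = 1 := by
    have h : ‖e‖ ^ 2 = 1 := by rw [he, one_pow]
    simpa [EuclideanSpace.norm_sq_eq, Fin.sum_univ_two] using h
  have h1' : e 0 * f1 0 + e 1 * f1 1 = c := by
    rw [← h1]; simp [PiLp.inner_apply, Fin.sum_univ_two]; ring
  have h2' : (e 0 * u 0 + e 1 * u 1) * v = σ2 * ε := by
    have h : e 0 * u 0 + e 1 * u 1 = σ2 * ε / v := by
      rw [← h2]; simp [PiLp.inner_apply, Fin.sum_univ_two]; ring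
    rw [h, div_mul_cancel₀ _ hv.ne']
  have hw : (e 1 * f1 0 - e 0 * f1 1) ^ 2 = N - c ^ 2 := by
    rw [← h1', hNdef]; linear_combination (f1 0 ^ 2 + f1 1 ^ 2) * he2
  have hg : v = g (e 1 * f1 0 - e 0 * f1 1) := by
    have hden : c * (f1 0 * u 0 + f1 1 * u 1)
        + (e 1 * f1 0 - e 0 * f1 1) * (f1 0 * u 1 - f1 1 * u 0)
        = N * (e 0 * u 0 + e 1 * u 1) := by
      rw [← h1', hNdef]; ring
    have hne : e 0 * u 0 + e 1 * u 1 ≠ 0 := by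
      intro h
      rw [h, zero_mul] at h2'
      exact mul_ne_zero hσ hε.ne' h2'.symm
    simp only [g]
    rw [hden, eq_div_iff (mul_ne_zero hN.ne' hne), ← h2']
    ring
  have hd : d ^ 2 = N - c ^ 2 := Real.sq_sqrt (hw ▸ sq_nonneg _)
  rcases sq_eq_sq_iff_eq_or_eq_neg.mp (hw.trans hd.symm) with h | h <;> rw [h] at hg
  · exact Or.inl hg
  · exact Or.inr hg
end

section
/- Let d ≥ 1, let V : ℝ^d → ℝ be a nonnegative Borel function, let x ∈ ℝ^d, let 0 ≤ δ < D and v > 0, and assume V(p) ≤ v for all p in the closed ball B̄(x, D). If γ : [0, τ] → ℝ^d is a V-path with ‖γ(0) − x‖ ≤ δ and ‖γ(τ) − x‖ > D, then τ > (D − δ)/v. -/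
open MeasureTheory

/-- A `V`-path with driving time `τ`: a continuous path `γ : [0, τ] → ℝ^d` respecting the
speed limits set by `V`, i.e. `‖γ(t2) − γ(t1)‖ ≤ ∫_{t1}^{t2} V(γ(t)) dt` for all
`0 ≤ t1 ≤ t2 ≤ τ`. -/
def IsVPath {d : ℕ} (V : EuclideanSpace ℝ (Fin d) → ℝ) (τ : ℝ)
    (γ : ℝ → EuclideanSpace ℝ (Fin d)) : Prop :=
  ContinuousOn γ (Set.Icc 0 τ) ∧
    ∀ t1 t2 : ℝ, 0 ≤ t1 → t1 ≤ t2 → t2 ≤ τ →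
      ‖γ t2 - γ t1‖ ≤ ∫ t in t1..t2, V (γ t)

/-- Confinement estimate: a `V`-path starting at distance at most `δ` from `x` and ending
outside the closed ball `B̄(x, D)`, where all speed limits on `B̄(x, D)` are at most `v`,
has driving time strictly greater than `(D − δ)/v`. -/
theorem vpath_exit_time_lower_bound
    (d : ℕ) (hd : 1 ≤ d) (V : EuclideanSpace ℝ (Fin d) → ℝ)
    (hV0 : ∀ p, 0 ≤ V p) (hVmeas : Measurable V)
    (x : EuclideanSpace ℝ (Fin d)) (δ D : ℝ) (hδ : 0 ≤ δ) (hδD : δ < D)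
    (v : ℝ) (hv : 0 < v)
    (hVle : ∀ p ∈ Metric.closedBall x D, V p ≤ v)
    (τ : ℝ) (hτ : 0 ≤ τ) (γ : ℝ → EuclideanSpace ℝ (Fin d))
    (hγ : IsVPath V τ γ)
    (hstart : ‖γ 0 - x‖ ≤ δ) (hend : D < ‖γ τ - x‖) :
    (D - δ) / v < τ := by
  obtain ⟨hcont, hspeed⟩ := hγ
  have hdist : ContinuousOn (fun t => ‖γ t - x‖) (Set.Icc 0 τ) :=
    (hcont.sub continuousOn_const).norm
  have hcross : ∀ t ∈ Set.Icc 0 τ, D < ‖γ t - x‖ → ∃ u ∈ Set.Icc 0 t, ‖γ u - x‖ = D := by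
    intro t ht hDt
    exact intermediate_value_Icc ht.1 (hdist.mono (Set.Icc_subset_Icc_right ht.2))
      ⟨(hstart.trans_lt hδD).le, hDt.le⟩
  -- The set of times at which the path is on the sphere has a least element.
  have hcompact : IsCompact (Set.Icc 0 τ ∩ (fun t => ‖γ t - x‖) ⁻¹' {D}) :=
    isCompact_Icc.of_isClosed_subset
      (hdist.preimage_isClosed_of_isClosed isClosed_Icc isClosed_singleton)
      Set.inter_subset_left
  obtain ⟨u, hu, huD⟩ := hcross τ ⟨hτ, le_rfl⟩ hend
  obtain ⟨s, ⟨hs, hsD⟩, hsmin⟩ := hcompact.exists_isLeast ⟨u, hu, huD⟩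
  replace hsD : ‖γ s - x‖ = D := hsD
  have hsτ : s < τ := by
    refine lt_of_le_of_ne hs.2 ?_
    rintro rfl
    exact hend.ne' hsD
  have hinside : ∀ t ∈ Set.Icc 0 s, ‖γ t - x‖ ≤ D := by
    intro t ht
    by_contra! hDt
    obtain ⟨r, hr, hrD⟩ := hcross t ⟨ht.1, ht.2.trans hs.2⟩ hDt
    have hsr : s ≤ r := hsmin ⟨⟨hr.1, hr.2.trans (ht.2.trans hs.2)⟩, hrD⟩
    have hts : t = s := le_antisymm ht.2 (hsr.trans hr.2)
    rw [hts] at hDt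
    exact hDt.ne' hsD
  have hint : ‖∫ t in (0 : ℝ)..s, V (γ t)‖ ≤ v * |s - 0| := by
    refine intervalIntegral.norm_integral_le_of_norm_le_const fun t ht => ?_
    rw [Set.uIoc_of_le hs.1] at ht
    rw [Real.norm_of_nonneg (hV0 _)]
    exact hVle _ (mem_closedBall_iff_norm.2 (hinside t ⟨ht.1.le, ht.2⟩))
  rw [sub_zero, abs_of_nonneg hs.1] at hint
  have hmove : ‖γ s - γ 0‖ ≤ v * s :=
    (hspeed 0 s le_rfl hs.1 hs.2).trans ((Real.le_norm_self _).trans hint)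
  have htri : ‖γ s - x‖ ≤ ‖γ s - γ 0‖ + ‖γ 0 - x‖ := norm_sub_le_norm_sub_add_norm_sub _ _ _
  refine lt_of_le_of_lt ?_ hsτ
  rw [div_le_iff₀ hv]
  linarith
end
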